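/- A group G has finite commutator subgroup (i.e., G is finite-by-abelian) if and only if G is locally (soluble-by-finite) and has the property K̄. -/

import Mathlib

/-- A group `G` has property K̄ if for every subgroup `X` of `G` the set of
subgroups of the form `⁅X, H⁆`, with `H` ranging over subgroups of `G`, is finite. -/
def PropK (G : Type*) [Group G] : Prop :=
  ∀ X : Subgroup G, {S : Subgroup G | ∃ H : Subgroup G, S = ⁅X, H⁆}.Finite

/-- A group is locally (soluble-by-finite) if every finitely generated subgroup
contains a solvable subgroup of finite index. -/
def LocallySolubleByFinite (G : Type*) [Group G] : Prop :=
  ∀ S : Subgroup G, S.FG → ∃ T : Subgroup S, IsSolvable T ∧ T.FiniteIndex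


lemma isJacobson_int : IsJacobsonRing ℤ := by
  rw [isJacobsonRing_iff_prime_eq]
  intro P hP
  by_cases h : P = ⊥
  · subst h
    rw [eq_bot_iff]
    intro x hx
    have h1 := Ideal.mem_jacobson_bot.1 hx x
    rw [Int.isUnit_iff] at h1
    have : x * x = 0 := by
      rcases h1 with h1 | h1
      · omega
      · nlinarith [mul_self_nonneg x]
    simpa using this
  · have := hP.isMaximal h
    exact Ideal.jacobson_eq_self_of_isMaximal

lemma finite_field_of_ft {R : Type*} [CommRing R] [Algebra ℤ R] [Algebra.FiniteType ℤ R] (K : Type*) [Field K]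
    (f : R →+* K) (hf : Function.Surjective f) : Finite K := by
  have hc : ∀ n : ℤ, f (algebraMap ℤ R n) = algebraMap ℤ K n := fun n => by
    rw [eq_intCast (algebraMap ℤ R), map_intCast, eq_intCast (algebraMap ℤ K)]
  have : Algebra.FiniteType ℤ K := Algebra.FiniteType.of_surjective (AlgHom.mk f hc) hf
  have := isJacobson_int
  have h1 : Module.Finite ℤ K := finite_of_finite_type_of_isJacobsonRing ℤ K
  obtain ⟨p, hp⟩ := CharP.exists K
  by_cases hp0 : p = 0
  · subst hp0
    have : CharZero K := CharP.charP_to_charZero K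
    have : Algebra.IsIntegral ℤ K := inferInstance
    have h2 : IsField ℤ := isField_of_isIntegral_of_isField
      (show Function.Injective (algebraMap ℤ K) from by simpa using Int.cast_injective) (Field.toIsField K)
    exact absurd h2 Int.not_isField
  · refine Module.finite_of_fg_torsion K ?_
    intro x
    refine ⟨⟨(p : ℤ), mem_nonZeroDivisors_of_ne_zero (by exact_mod_cast hp0)⟩, ?_⟩
    change (p : ℤ) • x = 0
    simp

lemma finite_of_isFiniteLength (R : Type*) [CommRing R] [Algebra ℤ R] [Algebra.FiniteType ℤ R]
    (M : Type*) [AddCommGroup M] [Module R M] (h : IsFiniteLength R M) : Finite M := by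
  induction h with
  | of_subsingleton => infer_instance
  | @of_simple_quotient M _ _ N hs _ ih =>
    obtain ⟨m, hm, ⟨e⟩⟩ := isSimpleModule_iff_quot_maximal.1 hs
    let : Field (R ⧸ m) := Ideal.Quotient.field m
    have : Finite (R ⧸ m) :=
      finite_field_of_ft (R ⧸ m) (Ideal.Quotient.mk m) Ideal.Quotient.mk_surjective
    have : Finite (M ⧸ N) := Finite.of_equiv _ e.symm.toEquiv
    have hN : Finite N.toAddSubgroup := ih
    have hQ : Finite (M ⧸ N.toAddSubgroup) := this
    exact Finite.of_equiv _ (AddSubgroup.addGroupEquivQuotientProdAddSubgroup (s := N.toAddSubgroup)).symm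

lemma finite_range_of_invariant (M : Type*) [AddCommGroup M] (t : M ≃+ M)
    (h : {C : AddSubgroup M | (∀ c ∈ C, ∃ a, c = t a - a) ∧ (∀ c ∈ C, t c ∈ C) ∧
      (∀ c ∈ C, t.symm c ∈ C)}.Finite) : {c | ∃ a, c = t a - a}.Finite := by
  let u : (Module.End ℤ M)ˣ :=
    ⟨t.toAddMonoidHom.toIntLinearMap, t.symm.toAddMonoidHom.toIntLinearMap,
      by ext; simp, by ext; simp⟩
  let f : AddMonoidAlgebra ℤ ℤ →ₐ[ℤ] Module.End ℤ M :=
    AddMonoidAlgebra.lift ℤ (Module.End ℤ M) ℤ ((Units.coeHom _).comp (zpowersHom _ u))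
  let : Module (AddMonoidAlgebra ℤ ℤ) M := Module.compHom M f.toRingHom
  have e1 : ∀ m : M, (AddMonoidAlgebra.single 1 1 : AddMonoidAlgebra ℤ ℤ) • m = t m := by
    intro m
    change f _ m = _
    rw [AddMonoidAlgebra.lift_single]
    simp [u]
  have e2 : ∀ m : M, (AddMonoidAlgebra.single (-1) 1 : AddMonoidAlgebra ℤ ℤ) • m = t.symm m := by
    intro m
    change f _ m = _
    rw [AddMonoidAlgebra.lift_single]
    simp [u]
  let L : M →ₗ[AddMonoidAlgebra ℤ ℤ] M :=
    LinearMap.lsmul _ M ((AddMonoidAlgebra.single 1 1 : AddMonoidAlgebra ℤ ℤ) - 1)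
  have eL : ∀ m, L m = t m - m := by
    intro m
    change ((AddMonoidAlgebra.single 1 1 : AddMonoidAlgebra ℤ ℤ) - 1) • m = _
    rw [sub_smul, e1, one_smul]
  let N := LinearMap.range L
  have hfin : Finite (Submodule (AddMonoidAlgebra ℤ ℤ) N) := by
    have := h.to_subtype
    let F : Submodule (AddMonoidAlgebra ℤ ℤ) N → {C : AddSubgroup M | (∀ c ∈ C, ∃ a, c = t a - a) ∧
        (∀ c ∈ C, t c ∈ C) ∧ (∀ c ∈ C, t.symm c ∈ C)} := fun S =>
      ⟨(S.map N.subtype).toAddSubgroup, by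
        refine ⟨?_, ?_, ?_⟩
        · rintro c ⟨⟨c, a, rfl⟩, -, rfl⟩
          exact ⟨a, eL a⟩
        · intro c hc
          rw [← e1]
          exact (S.map N.subtype).smul_mem _ hc
        · intro c hc
          rw [← e2]
          exact (S.map N.subtype).smul_mem _ hc⟩
    refine Finite.of_injective F ?_
    intro S T hST
    have : S.map N.subtype = T.map N.subtype := Submodule.toAddSubgroup_injective (congrArg Subtype.val hST)
    exact Submodule.map_injective_of_injective N.injective_subtype this
  have hN : IsFiniteLength (AddMonoidAlgebra ℤ ℤ) N :=
    isFiniteLength_iff_isNoetherian_isArtinian.2 ⟨isNoetherian_iff'.2 inferInstance, inferInstance⟩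
  have : AddMonoid.FG ℤ := AddGroup.fg_iff_addMonoid_fg.1 inferInstance
  have hft := AddMonoidAlgebra.finiteType_of_fg ℤ ℤ
  have : Finite N := @finite_of_isFiniteLength (AddMonoidAlgebra ℤ ℤ) _ _ hft N _ _ hN
  refine Set.Finite.subset (s := (N : Set M)) this ?_
  rintro c ⟨a, rfl⟩
  exact ⟨a, eL a⟩

open scoped commutatorElement

/-! ### Transfer of PropK -/

lemma PropK.of_surjective {G Q : Type*} [Group G] [Group Q] (h : PropK G) (f : G →* Q)
    (hf : Function.Surjective f) : PropK Q := by
  intro X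
  refine ((h (X.comap f)).image (Subgroup.map f)).subset ?_
  rintro S ⟨H, rfl⟩
  refine ⟨⁅X.comap f, H.comap f⁆, ⟨_, rfl⟩, ?_⟩
  rw [Subgroup.map_commutator, Subgroup.map_comap_eq_self_of_surjective hf,
    Subgroup.map_comap_eq_self_of_surjective hf]

lemma PropK.subgroup {G : Type*} [Group G] (h : PropK G) (S : Subgroup G) : PropK S := by
  intro X
  refine Set.Finite.of_finite_image (f := Subgroup.map S.subtype) ((h (X.map S.subtype)).subset ?_)
    (Subgroup.map_injective S.subtype_injective).injOn
  rintro _ ⟨_, ⟨H, rfl⟩, rfl⟩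
  exact ⟨H.map S.subtype, Subgroup.map_commutator _ _ _⟩

/-! ### Groups with finitely many subgroups -/

lemma finite_of_finite_subgroups {G : Type*} [Group G] (h : Finite (Subgroup G)) : Finite G := by
  have h1 : ∀ g : G, IsOfFinOrder g := by
    intro g
    by_contra hg
    have hinj : Function.Injective (fun n : ℕ => Subgroup.zpowers (g ^ n)) := by
      intro m n hmn
      have hmn : Subgroup.zpowers (g ^ m) = Subgroup.zpowers (g ^ n) := hmn
      have key : ∀ a b : ℕ, Subgroup.zpowers (g ^ a) = Subgroup.zpowers (g ^ b) → b ∣ a := by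
        intro a b hab
        have : g ^ a ∈ Subgroup.zpowers (g ^ b) := hab ▸ Subgroup.mem_zpowers _
        obtain ⟨k, hk⟩ := Subgroup.mem_zpowers_iff.1 this
        have h2 : g ^ ((b : ℤ) * k) = g ^ (a : ℤ) := by
          rw [zpow_mul, zpow_natCast, hk, zpow_natCast]
        have h3 := injective_zpow_iff_not_isOfFinOrder.2 hg h2
        exact Int.natCast_dvd_natCast.1 ⟨k, h3.symm⟩
      exact Nat.dvd_antisymm (key _ _ hmn.symm) (key _ _ hmn)
    exact not_injective_infinite_finite _ hinj
  have : (Set.univ : Set G) = ⋃ H ∈ {H : Subgroup G | (H : Set G).Finite}, (H : Set G) := by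
    ext g
    simp only [Set.mem_univ, Set.mem_iUnion, true_iff]
    refine ⟨Subgroup.zpowers g, ?_, Subgroup.mem_zpowers g⟩
    exact finite_zpowers.2 (h1 g)
  rw [← Set.finite_univ_iff, this]
  exact Set.Finite.biUnion (Set.toFinite _) fun H hH => hH

/-! ### Joins of finitely many finite normal subgroups -/

lemma finite_normal_sup {G ι : Type*} [Group G] (s : Finset ι) (f : ι → Subgroup G)
    (hn : ∀ i ∈ s, (f i).Normal) (hf : ∀ i ∈ s, (f i : Set G).Finite) :
    ∃ N : Subgroup G, N.Normal ∧ (N : Set G).Finite ∧ ∀ i ∈ s, f i ≤ N := by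
  classical
  induction s using Finset.induction_on with
  | empty => exact ⟨⊥, inferInstance, by simp, by simp⟩
  | insert a s ha ih =>
    obtain ⟨N, hN, hNf, hle⟩ := ih (fun i hi => hn i (Finset.mem_insert_of_mem hi))
      (fun i hi => hf i (Finset.mem_insert_of_mem hi))
    have h1 := hn a (Finset.mem_insert_self a s)
    refine ⟨f a ⊔ N, inferInstance, ?_, ?_⟩
    · rw [Subgroup.mul_normal]
      exact (hf a (Finset.mem_insert_self a s)).mul hNf
    · intro i hi
      rcases Finset.mem_insert.1 hi with rfl | hi
      · exact le_sup_left
      · exact (hle i hi).trans le_sup_right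

/-! ### FC modulo a subgroup -/

/-- `G` is FC modulo `N`. -/
def FCmod {G : Type*} [Group G] (N : Subgroup G) : Prop :=
  ∀ x : G, ∃ K : Subgroup G, K.FiniteIndex ∧ ∀ k ∈ K, ⁅x, k⁆ ∈ N

lemma FCmod.map {G Q : Type*} [Group G] [Group Q] (f : G →* Q) (hf : Function.Surjective f)
    {N : Subgroup G} (h : FCmod N) : FCmod (N.map f) := by
  intro y
  obtain ⟨x, rfl⟩ := hf y
  obtain ⟨K, hK, hx⟩ := h x
  refine ⟨K.map f, ⟨?_⟩, ?_⟩
  · exact ne_zero_of_dvd_ne_zero hK.index_ne_zero (Subgroup.index_map_dvd K hf)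
  · rintro _ ⟨k, hk, rfl⟩
    exact ⟨_, hx k hk, map_commutatorElement f x k⟩

lemma FCmod.comap {G Q : Type*} [Group G] [Group Q] (f : G →* Q)
    (hf : Function.Surjective f) {N : Subgroup Q} (h : FCmod N) : FCmod (N.comap f) := by
  intro x
  obtain ⟨K, hK, hx⟩ := h (f x)
  refine ⟨K.comap f, ⟨by rw [Subgroup.index_comap_of_surjective K hf]; exact hK.index_ne_zero⟩, ?_⟩
  intro k hk
  rw [Subgroup.mem_comap, map_commutatorElement]
  exact hx _ hk

lemma comm_step_central {G : Type*} [Group G] (h : PropK G) (A : Subgroup G)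
    (hA : A ≤ Subgroup.center G) (hfc : FCmod A) : FCmod (⊥ : Subgroup G) := by
  intro x
  obtain ⟨K, hK, hx⟩ := hfc x
  have hc : ∀ k ∈ K, ∀ g, ⁅x, k⁆ * g = g * ⁅x, k⁆ := fun k hk g =>
    ((Subgroup.mem_center_iff.1 (hA (hx k hk))) g).symm
  let φ : K →* G :=
    { toFun := fun k => ⁅x, (k : G)⁆
      map_one' := by simp
      map_mul' := by
        rintro ⟨a, ha⟩ ⟨b, hb⟩
        have h1 := hc b hb a
        have h2 : ⁅x, a * b⁆ = ⁅x, a⁆ * (a * ⁅x, b⁆ * a⁻¹) := by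
          simp only [commutatorElement_def]; group
        change ⁅x, a * b⁆ = ⁅x, a⁆ * ⁅x, b⁆
        rw [h2, ← h1]; simp }
  have hφ : ∀ k : K, φ k = ⁅x, (k : G)⁆ := fun k => rfl
  have hfin : Finite (Subgroup φ.range) := by
    have := (h (Subgroup.zpowers x)).to_subtype
    let F : Subgroup φ.range → {S : Subgroup G | ∃ H : Subgroup G, S = ⁅Subgroup.zpowers x, H⁆} :=
      fun J => ⟨J.map φ.range.subtype, ((J.map φ.range.subtype).comap φ).map K.subtype, by
        apply le_antisymm
        · rintro _ ⟨⟨_, k, rfl⟩, hk, rfl⟩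
          change φ k ∈ _
          rw [hφ]
          refine Subgroup.commutator_mem_commutator (Subgroup.mem_zpowers x) ⟨k, ?_, rfl⟩
          exact ⟨⟨φ k, k, rfl⟩, hk, rfl⟩
        · rw [Subgroup.commutator_le]
          rintro _ ⟨n, rfl⟩ _ ⟨k, hk, rfl⟩
          have hk' : ⁅x, (k : G)⁆ ∈ J.map φ.range.subtype := hk
          have hcc := hc k k.2
          have e1 : (k : G) * x * (k : G)⁻¹ = ⁅x, (k : G)⁆⁻¹ * x := by
            simp only [commutatorElement_def]; group
          have e2 : ⁅x ^ n, (k : G)⁆ = ⁅x, (k : G)⁆ ^ n := by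
            have e3 : ⁅x ^ n, (k : G)⁆ = x ^ n * ((k : G) * x * (k : G)⁻¹) ^ (-n) := by
              rw [conj_zpow]; simp only [commutatorElement_def]; group
            have cm : Commute ⁅x, (k : G)⁆ x := hcc x
            rw [e3, e1, (cm.inv_left).mul_zpow, ((cm.inv_left).zpow_zpow (-n) (-n)).eq,
              inv_zpow', neg_neg, zpow_neg, mul_inv_cancel_left]
          change ⁅x ^ n, (k : G)⁆ ∈ _
          rw [e2]
          exact Subgroup.zpow_mem _ hk' n⟩
    refine Finite.of_injective F fun S T hST => ?_
    exact Subgroup.map_injective φ.range.subtype_injective (congrArg Subtype.val hST)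
  have : Finite φ.range := finite_of_finite_subgroups hfin
  have hker : φ.ker.FiniteIndex := inferInstance
  refine ⟨φ.ker.map K.subtype, ⟨?_⟩, ?_⟩
  · rw [Subgroup.index_map_subtype]
    exact mul_ne_zero hker.index_ne_zero hK.index_ne_zero
  · rintro _ ⟨k, hk, rfl⟩
    exact hk

lemma comm_step_finite {G : Type*} [Group G] (F : Subgroup G) [F.Normal]
    (hF : (F : Set G).Finite) (hfc : FCmod F) : FCmod (⊥ : Subgroup G) := by
  intro x
  obtain ⟨K, hK, hx⟩ := hfc x
  have hFf : Finite F := hF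
  let C : Subgroup G := (MulAut.conjNormal (H := F)).ker
  have hfinAut : Finite (MulAut F) := Finite.of_injective (fun e : MulAut F => (e : F → F)) 
    DFunLike.coe_injective
  have hC : C.FiniteIndex := Subgroup.finiteIndex_ker _
  have hCc : ∀ c ∈ C, ∀ f ∈ F, c * f * c⁻¹ = f := by
    intro c hc f hf
    have h1 : MulAut.conjNormal (H := F) c = 1 := hc
    have h2 := congrArg (fun e : MulAut F => ((e ⟨f, hf⟩ : F) : G)) h1
    simpa using h2
  let L := K ⊓ C
  have hL : L.FiniteIndex := inferInstance
  let φ : L →* F :=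
    { toFun := fun k => ⟨⁅x, (k : G)⁆, hx k k.2.1⟩
      map_one' := by simp
      map_mul' := by
        rintro ⟨a, ha⟩ ⟨b, hb⟩
        apply Subtype.ext
        have h1 := hCc a ha.2 _ (hx b hb.1)
        have h2 : ⁅x, a * b⁆ = ⁅x, a⁆ * (a * ⁅x, b⁆ * a⁻¹) := by
          simp only [commutatorElement_def]; group
        change ⁅x, a * b⁆ = ⁅x, a⁆ * ⁅x, b⁆
        rw [h2, h1] }
  have hker : φ.ker.FiniteIndex := inferInstance
  refine ⟨φ.ker.map L.subtype, ⟨?_⟩, ?_⟩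
  · rw [Subgroup.index_map_subtype]
    exact mul_ne_zero hker.index_ne_zero hL.index_ne_zero
  · rintro _ ⟨k, hk, rfl⟩
    exact congrArg Subtype.val (show φ k = 1 from hk)

/-! ### The abelian normal subgroup step -/

/-- Elements normalizing `H` and centralizing it modulo `S`. -/
def commSub {G : Type*} [Group G] (H S : Subgroup G) : Subgroup G where
  carrier := {y | ∀ a ∈ H, y * a * y⁻¹ ∈ H ∧ y⁻¹ * a * y ∈ H ∧ ⁅y, a⁆ ∈ S}
  one_mem' := by
    intro a ha
    simp [ha]
  mul_mem' := by
    intro y z hy hz a ha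
    refine ⟨?_, ?_, ?_⟩
    · have := (hy _ (hz a ha).1).1
      simpa [mul_assoc] using this
    · have := (hz _ (hy a ha).2.1).2.1
      simpa [mul_assoc] using this
    · have e : ⁅y * z, a⁆ = ⁅y, z * a * z⁻¹⁆ * ⁅z, a⁆ := by
        simp only [commutatorElement_def]; group
      rw [e]
      exact S.mul_mem (hy _ (hz a ha).1).2.2 (hz a ha).2.2
  inv_mem' := by
    intro y hy a ha
    refine ⟨by simpa using (hy a ha).2.1, by simpa using (hy a ha).1, ?_⟩
    have e : ⁅y⁻¹, a⁆ = ⁅y, y⁻¹ * a * y⁆⁻¹ := by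
      simp only [commutatorElement_def]; group
    rw [e]
    exact S.inv_mem (hy _ (hy a ha).2.1).2.2

lemma mem_commSub {G : Type*} [Group G] {H S : Subgroup G} {y : G} :
    y ∈ commSub H S ↔ ∀ a ∈ H, y * a * y⁻¹ ∈ H ∧ y⁻¹ * a * y ∈ H ∧ ⁅y, a⁆ ∈ S := Iff.rfl

/-- Commutation with `x` on an abelian normal subgroup. -/
def commHom {G : Type*} [Group G] (A : Subgroup G) [hn : A.Normal]
    (hab : ∀ a ∈ A, ∀ b ∈ A, a * b = b * a) (x : G) : A →* A where
  toFun a := ⟨⁅x, (a : G)⁆, by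
    rw [commutatorElement_def]
    exact A.mul_mem (hn.conj_mem _ a.2 x) (A.inv_mem a.2)⟩
  map_one' := by simp
  map_mul' := by
    rintro ⟨a, ha⟩ ⟨b, hb⟩
    apply Subtype.ext
    have hc : ⁅x, b⁆ ∈ A := by
      rw [commutatorElement_def]
      exact A.mul_mem (hn.conj_mem _ hb x) (A.inv_mem hb)
    have h1 := hab a ha _ hc
    have h2 : ⁅x, a * b⁆ = ⁅x, a⁆ * (a * ⁅x, b⁆ * a⁻¹) := by
      simp only [commutatorElement_def]; group
    change ⁅x, a * b⁆ = ⁅x, a⁆ * ⁅x, b⁆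
    rw [h2, h1]; simp

lemma finite_commHom_range {G : Type*} [Group G] (h : PropK G) (A : Subgroup G) [hn : A.Normal]
    (hab : ∀ a ∈ A, ∀ b ∈ A, a * b = b * a) (x : G) :
    ((commHom A hab x).range : Set A).Finite := by
  let inst : CommGroup A :=
    { (inferInstance : Group A) with
      mul_comm := fun a b => Subtype.ext (hab a a.2 b b.2) }
  let t : Additive A ≃+ Additive A := MulEquiv.toAdditive (MulAut.conjNormal x : MulAut A)
  have ht : ∀ a : A, (((t (Additive.ofMul a)).toMul : A) : G) = x * a * x⁻¹ := fun a => rfl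
  have hts : ∀ a : A, (((t.symm (Additive.ofMul a)).toMul : A) : G) = x⁻¹ * a * x := fun a =>
    MulAut.conjNormal_symm_apply x a
  have key := finite_range_of_invariant (Additive A) t (by
    refine Set.Finite.of_finite_image
      (f := fun C : AddSubgroup (Additive A) => (AddSubgroup.toSubgroup' C).map A.subtype)
      ((h (Subgroup.zpowers x)).subset ?_) ?_
    · rintro _ ⟨C, ⟨hC1, hC2, hC3⟩, rfl⟩
      set S := (AddSubgroup.toSubgroup' C).map A.subtype with hS
      have hSA : S ≤ A := by
        rintro _ ⟨c, -, rfl⟩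
        exact c.2
      have s1 : ∀ c ∈ S, ∃ a ∈ A, c = ⁅x, a⁆ := by
        rintro _ ⟨c, hc, rfl⟩
        obtain ⟨a, ha⟩ := hC1 (Additive.ofMul c) hc
        refine ⟨(a.toMul : A), (a.toMul : A).2, ?_⟩
        have := congrArg (fun z : Additive A => ((z.toMul : A) : G)) ha
        have h2 := ht a.toMul
        rw [ofMul_toMul] at h2
        rw [commutatorElement_def, ← h2]
        simpa [div_eq_mul_inv] using this
      have s2 : ∀ c ∈ S, x * c * x⁻¹ ∈ S := by
        rintro _ ⟨c, hc, rfl⟩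
        exact ⟨(t (Additive.ofMul c)).toMul, hC2 _ hc, ht c⟩
      have s3 : ∀ c ∈ S, x⁻¹ * c * x ∈ S := by
        rintro _ ⟨c, hc, rfl⟩
        exact ⟨(t.symm (Additive.ofMul c)).toMul, hC3 _ hc, hts c⟩
      let H : Subgroup G := (S.comap (A.subtype.comp (commHom A hab x))).map A.subtype
      have hH : ∀ a, a ∈ H ↔ a ∈ A ∧ ⁅x, a⁆ ∈ S := by
        intro a
        constructor
        · rintro ⟨a, ha, rfl⟩
          exact ⟨a.2, ha⟩
        · rintro ⟨ha, hs⟩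
          exact ⟨⟨a, ha⟩, hs, rfl⟩
      refine ⟨H, le_antisymm ?_ ?_⟩
      · intro c hc
        obtain ⟨a, ha, rfl⟩ := s1 c hc
        exact Subgroup.commutator_mem_commutator (Subgroup.mem_zpowers x) ((hH a).2 ⟨ha, hc⟩)
      · have hx : x ∈ commSub H S := by
          rw [mem_commSub]
          intro a ha
          rw [hH] at ha
          refine ⟨?_, ?_, ha.2⟩
          · rw [hH]
            refine ⟨hn.conj_mem _ ha.1 x, ?_⟩
            have e : ⁅x, x * a * x⁻¹⁆ = x * ⁅x, a⁆ * x⁻¹ := by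
              simp only [commutatorElement_def]; group
            rw [e]
            exact s2 _ ha.2
          · rw [hH]
            refine ⟨by simpa using hn.conj_mem _ ha.1 x⁻¹, ?_⟩
            have e : ⁅x, x⁻¹ * a * x⁆ = x⁻¹ * ⁅x, a⁆ * x := by
              simp only [commutatorElement_def]; group
            rw [e]
            exact s3 _ ha.2
        rw [Subgroup.commutator_le]
        intro y hy a ha
        have : y ∈ commSub H S := (Subgroup.zpowers_le.2 hx) hy
        exact (this a ha).2.2
    · intro C _ D _ hCD
      exact AddSubgroup.toSubgroup'.injective (Subgroup.map_injective A.subtype_injective hCD))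
  refine (key.image Additive.toMul).subset ?_
  rintro _ ⟨a, rfl⟩
  refine ⟨t (Additive.ofMul a) - Additive.ofMul a, ⟨_, rfl⟩, ?_⟩
  apply Subtype.ext
  change _ = x * (a : G) * x⁻¹ * (a : G)⁻¹
  rw [← ht a, toMul_sub, toMul_ofMul, div_eq_mul_inv]
  rfl

lemma finite_commutator_abelian {G : Type*} [Group G] [Group.FG G] (h : PropK G) (A : Subgroup G)
    [hn : A.Normal] (hab : ∀ a ∈ A, ∀ b ∈ A, a * b = b * a) :
    ((⁅A, ⊤⁆ : Subgroup G) : Set G).Finite := by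
  obtain ⟨s, hs⟩ := (Group.fg_def.1 (inferInstance : Group.FG G))
  let inst : CommGroup A :=
    { (inferInstance : Group A) with
      mul_comm := fun a b => Subtype.ext (hab a a.2 b b.2) }
  obtain ⟨N, -, hNf, hN⟩ := finite_normal_sup s (fun x => (commHom A hab x).range)
    (fun i _ => inferInstanceAs ((commHom A hab i).range.Normal))
    (fun i _ => finite_commHom_range h A hab i)
  refine (hNf.image A.subtype).subset ?_
  have : (⊤ : Subgroup G) ≤ commSub A (N.map A.subtype) := by
    rw [← hs, Subgroup.closure_le]
    intro x hx a ha
    refine ⟨hn.conj_mem _ ha x, by simpa using hn.conj_mem _ ha x⁻¹, ?_⟩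
    exact ⟨_, hN x hx ⟨⟨a, ha⟩, rfl⟩, rfl⟩
  have h2 : ⁅A, ⊤⁆ ≤ N.map A.subtype := by
    rw [Subgroup.commutator_comm, Subgroup.commutator_le]
    intro y hy a ha
    exact (this hy a ha).2.2
  exact h2

/-! ### The induction -/

lemma fc_step1 {G : Type*} [Group G] (h : PropK G) (A : Subgroup G) [A.Normal]
    (hfc : FCmod A) : FCmod ⁅A, (⊤ : Subgroup G)⁆ := by
  have hs := QuotientGroup.mk'_surjective ⁅A, (⊤ : Subgroup G)⁆
  have h1 := comm_step_central (h.of_surjective _ hs)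
    (A.map (QuotientGroup.mk' ⁅A, (⊤ : Subgroup G)⁆)) (by
      rintro _ ⟨a, ha, rfl⟩
      rw [Subgroup.mem_center_iff]
      intro y
      obtain ⟨g, rfl⟩ := hs y
      symm
      rw [← commutatorElement_eq_one_iff_mul_comm, ← map_commutatorElement]
      exact (QuotientGroup.eq_one_iff _).2
        (Subgroup.commutator_mem_commutator ha (Subgroup.mem_top g))) (hfc.map _ hs)
  have h2 := h1.comap _ hs
  rwa [MonoidHom.comap_bot, QuotientGroup.ker_mk'] at h2

lemma fc_step2 {G : Type*} [Group G] [Group.FG G] (h : PropK G) (A : Subgroup G) [A.Normal]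
    (hfc : FCmod ⁅A, (⊤ : Subgroup G)⁆) : FCmod ⁅A, A⁆ := by
  have hs := QuotientGroup.mk'_surjective ⁅A, A⁆
  have hAn : (A.map (QuotientGroup.mk' ⁅A, A⁆)).Normal := Subgroup.Normal.map inferInstance _ hs
  have hfin := finite_commutator_abelian (h.of_surjective _ hs)
    (A.map (QuotientGroup.mk' ⁅A, A⁆)) (by
      rintro _ ⟨a, ha, rfl⟩ _ ⟨b, hb, rfl⟩
      rw [← commutatorElement_eq_one_iff_mul_comm, ← map_commutatorElement]
      exact (QuotientGroup.eq_one_iff _).2 (Subgroup.commutator_mem_commutator ha hb))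
  have e : (⁅A, (⊤ : Subgroup G)⁆).map (QuotientGroup.mk' ⁅A, A⁆) =
      ⁅A.map (QuotientGroup.mk' ⁅A, A⁆), ⊤⁆ := by
    rw [Subgroup.map_commutator, Subgroup.map_top_of_surjective _ hs]
  have h1 := hfc.map _ hs
  rw [e] at h1
  have h2 := (comm_step_finite _ hfin h1).comap _ hs
  rwa [MonoidHom.comap_bot, QuotientGroup.ker_mk'] at h2

lemma fc_of_solvable {G : Type*} [Group G] [Group.FG G] (h : PropK G) (T : Subgroup G)
    [hn : T.Normal] (hT : T.FiniteIndex) (hsol : Group.IsSolvable T) : FCmod (⊥ : Subgroup G) := by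
  have key : ∀ n, ((derivedSeries T n).map T.subtype).Normal ∧
      FCmod ((derivedSeries T n).map T.subtype) := by
    intro n
    induction n with
    | zero =>
      rw [derivedSeries_zero, ← MonoidHom.range_eq_map, Subgroup.range_subtype]
      refine ⟨hn, fun x => ⟨T, hT, fun k hk => ?_⟩⟩
      rw [commutatorElement_def]
      exact T.mul_mem (hn.conj_mem k hk x) (T.inv_mem hk)
    | succ n ih =>
      obtain ⟨h1, h2⟩ := ih
      rw [derivedSeries_succ, Subgroup.map_commutator]
      exact ⟨inferInstance, fc_step2 h _ (fc_step1 h _ h2)⟩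
  obtain ⟨n, hn⟩ := hsol.solvable
  have := (key n).2
  rwa [hn, Subgroup.map_bot] at this

lemma finite_commutator_of_fc {G : Type*} [Group G] [Group.FG G] (h : FCmod (⊥ : Subgroup G)) :
    Finite (commutator G) := by
  obtain ⟨s, hs⟩ := (Group.fg_def.1 (inferInstance : Group.FG G))
  choose K hK hx using h
  have hI : (⨅ g ∈ s, K g).FiniteIndex := Subgroup.finiteIndex_iInf' _ fun i _ => hK i
  have hle : (⨅ g ∈ s, K g) ≤ Subgroup.center G := by
    intro k hk
    simp only [Subgroup.mem_iInf] at hk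
    have : (⊤ : Subgroup G) ≤ Subgroup.centralizer {k} := by
      rw [← hs, Subgroup.closure_le]
      intro g hg
      have h1 : ⁅g, k⁆ = 1 := hx g k (hk g hg)
      rw [commutatorElement_eq_one_iff_mul_comm] at h1
      exact Subgroup.mem_centralizer_singleton_iff.2 h1
    rw [Subgroup.mem_center_iff]
    intro g
    exact Subgroup.mem_centralizer_singleton_iff.1 (this (Subgroup.mem_top g))
  have hZ : (Subgroup.center G).FiniteIndex := Subgroup.finiteIndex_of_le hle
  have hQ : Finite (G ⧸ Subgroup.center G) := inferInstance
  have : Finite (commutatorSet G) := by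
    refine (Set.finite_range (fun p : (G ⧸ Subgroup.center G) × (G ⧸ Subgroup.center G) =>
      ⁅p.1.out, p.2.out⁆)).subset ?_
    rintro _ ⟨a, b, rfl⟩
    refine ⟨(QuotientGroup.mk a, QuotientGroup.mk b), ?_⟩
    obtain ⟨y, hy⟩ := QuotientGroup.mk_out_eq_mul (Subgroup.center G) a
    obtain ⟨z, hz⟩ := QuotientGroup.mk_out_eq_mul (Subgroup.center G) b
    have cy := Subgroup.mem_center_iff.1 y.2
    have cz := Subgroup.mem_center_iff.1 z.2
    simp only [hy, hz]
    have e1 : ⁅a * (y : G), b * (z : G)⁆ = a * (y * (b * z)) * (y : G)⁻¹ * a⁻¹ * (b * z)⁻¹ := by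
      simp only [commutatorElement_def]; group
    rw [e1, ← cy]
    have e2 : a * (b * (z : G) * (y : G)) * (y : G)⁻¹ * a⁻¹ * (b * (z : G))⁻¹ =
      a * b * (z * a⁻¹) * (z : G)⁻¹ * b⁻¹ := by group
    rw [e2, ← cz]
    simp only [commutatorElement_def]; group
  infer_instance

lemma exists_fg_commutator {G : Type*} [Group G] (h : PropK G) (X : Subgroup G) :
    ∃ H : Subgroup G, H.FG ∧ ⁅X, ⊤⁆ ≤ ⁅X, H⁆ := by
  have hf : {S : Subgroup G | ∃ H : Subgroup G, H.FG ∧ S = ⁅X, H⁆}.Finite :=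
    (h X).subset fun S ⟨H, _, hS⟩ => ⟨H, hS⟩
  obtain ⟨M, hM⟩ := hf.exists_maximal ⟨⁅X, ⊥⁆, ⊥, Subgroup.FG.bot, rfl⟩
  obtain ⟨H, hH, rfl⟩ := hM.prop
  refine ⟨H, hH, ?_⟩
  rw [Subgroup.commutator_le]
  intro x hx g _
  have hg : (Subgroup.zpowers g).FG := ⟨{g}, by simp [Subgroup.zpowers_eq_closure]⟩
  have h1 : ⁅X, H⁆ ≤ ⁅X, H ⊔ Subgroup.zpowers g⁆ := Subgroup.commutator_mono le_rfl le_sup_left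
  exact hM.le_of_ge ⟨_, hH.sup hg, rfl⟩ h1 (Subgroup.commutator_mem_commutator hx
    (Subgroup.mem_sup_right (Subgroup.mem_zpowers g)))

lemma normal_commutator_top {G : Type*} [Group G] (X : Subgroup G) :
    (⁅X, (⊤ : Subgroup G)⁆).Normal := by
  have : ∀ k : G, ⁅X, (⊤ : Subgroup G)⁆ ≤ (⁅X, (⊤ : Subgroup G)⁆).comap (MulAut.conj k).toMonoidHom := by
    intro k
    rw [Subgroup.commutator_le]
    intro x hx g _
    have e : k * ⁅x, g⁆ * k⁻¹ = ⁅x, k⁆⁻¹ * ⁅x, k * g⁆ := by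
      simp only [commutatorElement_def]; group
    change k * ⁅x, g⁆ * k⁻¹ ∈ ⁅X, (⊤ : Subgroup G)⁆
    rw [e]
    exact Subgroup.mul_mem _ (Subgroup.inv_mem _ (Subgroup.commutator_mem_commutator hx
      (Subgroup.mem_top _))) (Subgroup.commutator_mem_commutator hx (Subgroup.mem_top _))
  exact ⟨fun n hn g => this g hn⟩

lemma backward {G : Type*} [Group G] (hl : LocallySolubleByFinite G) (h : PropK G) :
    Finite (commutator G) := by
  -- finitely generated subgroups have finite commutator subgroup
  have hfg : ∀ S : Subgroup G, S.FG → ((⁅S, S⁆ : Subgroup G) : Set G).Finite := by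
    intro S hS
    obtain ⟨T, hT, hTi⟩ := hl S hS
    have : Group.FG S := (Group.fg_iff_subgroup_fg S).2 hS
    have hT' : Group.IsSolvable T := hT
    have hsol : Group.IsSolvable T.normalCore :=
      Group.isSolvable_of_isSolvable_injective (Subgroup.inclusion_injective T.normalCore_le)
    have := finite_commutator_of_fc (fc_of_solvable (h.subgroup S) T.normalCore inferInstance hsol)
    have h2 : ((commutator S : Subgroup S) : Set S).Finite := this
    have h3 := h2.image S.subtype
    have e : (commutator S).map S.subtype = ⁅S, S⁆ := by
      rw [commutator_def, Subgroup.map_commutator, ← MonoidHom.range_eq_map, Subgroup.range_subtype]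
    rw [← e]
    exact h3
  have hx : ∀ x : G, ((⁅Subgroup.zpowers x, ⊤⁆ : Subgroup G) : Set G).Finite := by
    intro x
    obtain ⟨H, hH, hle⟩ := exists_fg_commutator h (Subgroup.zpowers x)
    have hg : (Subgroup.zpowers x).FG := ⟨{x}, by simp [Subgroup.zpowers_eq_closure]⟩
    exact (hfg _ (hg.sup hH)).subset
      (hle.trans (Subgroup.commutator_mono le_sup_left le_sup_right))
  obtain ⟨H, ⟨s, hs⟩, hle⟩ := exists_fg_commutator h (⊤ : Subgroup G)
  obtain ⟨N, hN, hNf, hNs⟩ := finite_normal_sup s (fun x => ⁅Subgroup.zpowers x, ⊤⁆)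
    (fun i _ => normal_commutator_top _) (fun i _ => hx i)
  have h1 : H ≤ commSub ⊤ N := by
    rw [← hs, Subgroup.closure_le]
    intro x hx a _
    exact ⟨trivial, trivial, hNs x hx (Subgroup.commutator_mem_commutator
      (Subgroup.mem_zpowers x) (Subgroup.mem_top a))⟩
  have h2 : commutator G ≤ N := by
    rw [commutator_def]
    refine hle.trans ?_
    rw [Subgroup.commutator_comm, Subgroup.commutator_le]
    intro y hy a ha
    exact (h1 hy a ha).2.2
  exact (hNf.subset h2 : ((commutator G : Subgroup G) : Set G).Finite)

lemma forward {G : Type*} [Group G] (h : Finite (commutator G)) :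
    LocallySolubleByFinite G ∧ PropK G := by
  have hF : ((commutator G : Subgroup G) : Set G).Finite := h
  constructor
  · intro S _
    have hfinAut : Finite (MulAut (commutator G)) :=
      Finite.of_injective (fun e : MulAut (commutator G) => (e : commutator G → commutator G))
        DFunLike.coe_injective
    let C : Subgroup G := (MulAut.conjNormal (H := commutator G)).ker
    have hC : C.FiniteIndex := Subgroup.finiteIndex_ker _
    have hCc : ∀ c ∈ C, ∀ f ∈ commutator G, c * f = f * c := by
      intro c hc f hf
      have h1 : MulAut.conjNormal (H := commutator G) c = 1 := hc
      have h2 := congrArg (fun e : MulAut (commutator G) => ((e ⟨f, hf⟩ : commutator G) : G)) h1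
      have h3 : c * f * c⁻¹ = f := by simpa using h2
      exact mul_inv_eq_iff_eq_mul.1 h3
    have hsol : Group.IsSolvable C := by
      refine ⟨⟨2, ?_⟩⟩
      rw [derivedSeries_succ, derivedSeries_one, Subgroup.commutator_eq_bot_iff_le_centralizer]
      intro a _
      rw [Subgroup.mem_centralizer_iff]
      intro b hb
      have hb' : (b : G) ∈ commutator G := by
        have : commutator C ≤ (commutator G).comap C.subtype := by
          rw [commutator_def, Subgroup.commutator_le]
          intro p _ q _
          exact Subgroup.commutator_mem_commutator (Subgroup.mem_top _) (Subgroup.mem_top _)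
        exact this hb
      exact Subtype.ext (hCc a a.2 b hb').symm
    refine ⟨C.subgroupOf S, ?_, inferInstance⟩
    let f : C.subgroupOf S →* C :=
      { toFun := fun a => ⟨((a : S) : G), a.2⟩
        map_one' := rfl
        map_mul' := fun _ _ => rfl }
    refine Group.isSolvable_of_isSolvable_injective (f := f) ?_
    intro a b hab
    exact Subtype.ext (Subtype.ext (congrArg (fun c : C => (c : G)) hab))
  · intro X
    have hp : {S : Subgroup G | (S : Set G) ⊆ commutator G}.Finite :=
      Set.Finite.of_finite_image (f := fun S : Subgroup G => (S : Set G))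
        (hF.finite_subsets.subset (by rintro _ ⟨S, hS, rfl⟩; exact hS))
        SetLike.coe_injective.injOn
    refine hp.subset ?_
    rintro _ ⟨H, rfl⟩
    have : ⁅X, H⁆ ≤ commutator G := by
      rw [commutator_def]
      exact Subgroup.commutator_mono le_top le_top
    exact this

theorem stmt_0 (G : Type*) [Group G] :
    Finite (commutator G) ↔ LocallySolubleByFinite G ∧ PropK G :=
  ⟨forward, fun h => backward h.1 h.2⟩
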